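/- arXiv:1801.08608 — 4 statements merged into one kernel-verified Lean document; each statement's English description precedes it below -/
import Mathlib

section
/- Let 𝒜 be an ℓ-algebra with a positive multiplicative unit e, and let a ∈ I_e, i.e. there exists λ ≥ 0 with |a| ≤ λ·e. If φ ∈ 𝒜 is a finite element with majorant u, then the products φ·a and a·φ are finite elements with the same majorant u; if φ is totally finite with a finite majorant u, then φ·a and a·φ are totally finite with majorant u. -/
namespace FiniteElementsPaper

/-- Product of `p` factors `φ 0 * φ 1 * ⋯ * φ (p-1)` in a (possibly non-unital)
multiplicative structure; junk value `0` when `p = 0`. -/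
def mulProd {A : Type*} [Mul A] [Zero A] : (p : ℕ) → (Fin p → A) → A
  | 0, _ => 0
  | q + 1, φ => Fin.foldl q (fun acc i => acc * φ i.succ) (φ 0)

/-- `p`-th power `a^p` (junk value `0` for `p = 0`). -/
def mpow {A : Type*} [Mul A] [Zero A] (a : A) (p : ℕ) : A :=
  mulProd p (fun _ => a)

/-- The set `Π_p(𝒜)` of all `p`-fold products. -/
def piSet (A : Type*) [Mul A] [Zero A] (p : ℕ) : Set A :=
  {x | ∃ φ : Fin p → A, x = mulProd p φ}

variable {A : Type*} [Lattice A] [AddCommGroup A] [Module ℝ A]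

/-- `z` is a majorant of `φ`: `z ≥ 0` and for every `x` there is `c > 0` with
`|x| ⊓ n • |φ| ≤ c • z` for all `n`. -/
def IsMajorant (z φ : A) : Prop :=
  0 ≤ z ∧ ∀ x : A, ∃ c : ℝ, 0 < c ∧ ∀ n : ℕ, |x| ⊓ n • |φ| ≤ c • z

/-- `φ` is a finite element. -/
def IsFiniteElt (φ : A) : Prop := ∃ z : A, IsMajorant z φ

/-- `φ` is a totally finite element: it has a majorant which is itself finite. -/
def IsTotallyFiniteElt (φ : A) : Prop := ∃ z : A, IsMajorant z φ ∧ IsFiniteElt z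

/-- `φ` is self-majorizing: `|φ|` is a majorant of `φ`. -/
def IsSelfMajorizing (φ : A) : Prop := IsMajorant |φ| φ

/-- `φ ∈ Φ₃(A) = S₊(A) - S₊(A)`. -/
def InPhi3 (φ : A) : Prop :=
  ∃ s t : A, 0 ≤ s ∧ 0 ≤ t ∧ IsSelfMajorizing s ∧ IsSelfMajorizing t ∧ φ = s - t

/-- `w` is a majorant of `φ` relative to the subset `S` (all lattice operations
computed in the ambient algebra). -/
def IsMajorantIn (S : Set A) (w φ : A) : Prop :=
  0 ≤ w ∧ ∀ x ∈ S, ∃ c : ℝ, 0 < c ∧ ∀ n : ℕ, |x| ⊓ n • |φ| ≤ c • w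

/-- `φ` is a finite element of the sublattice `S` (majorant required to lie in `S`). -/
def IsFiniteEltIn (S : Set A) (φ : A) : Prop := ∃ w ∈ S, IsMajorantIn S w φ

/-- `φ` is a totally finite element of the sublattice `S`. -/
def IsTotallyFiniteEltIn (S : Set A) (φ : A) : Prop :=
  ∃ w ∈ S, IsMajorantIn S w φ ∧ IsFiniteEltIn S w

/-- `φ` is self-majorizing in the sublattice `S`. -/
def IsSelfMajorizingIn (S : Set A) (φ : A) : Prop := IsMajorantIn S |φ| φ

/-- `φ ∈ Φ₃(S) = S₊(S) - S₊(S)` for the sublattice `S`. -/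
def InPhi3In (S : Set A) (φ : A) : Prop :=
  ∃ s t : A, s ∈ S ∧ t ∈ S ∧ 0 ≤ s ∧ 0 ≤ t ∧
    IsSelfMajorizingIn S s ∧ IsSelfMajorizingIn S t ∧ φ = s - t

variable (A) in
/-- Archimedean ℓ-algebra structure: an Archimedean vector lattice together with an
associative bilinear multiplication whose product of positive elements is positive. -/
structure IsLAlgebra [Mul A] : Prop where
  add_le_add_left : ∀ a b : A, a ≤ b → ∀ c : A, c + a ≤ c + b
  smul_le_smul : ∀ (r : ℝ) (a b : A), 0 ≤ r → a ≤ b → r • a ≤ r • b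
  archimedean : ∀ a b : A, 0 ≤ a → (∀ n : ℕ, n • a ≤ b) → a = 0
  mul_assoc : ∀ a b c : A, a * b * c = a * (b * c)
  left_distrib : ∀ a b c : A, a * (b + c) = a * b + a * c
  right_distrib : ∀ a b c : A, (a + b) * c = a * c + b * c
  smul_mul : ∀ (r : ℝ) (a b : A), (r • a) * b = r • (a * b)
  mul_smul : ∀ (r : ℝ) (a b : A), a * (r • b) = r • (a * b)
  mul_nonneg : ∀ a b : A, 0 ≤ a → 0 ≤ b → 0 ≤ a * b

variable (A) in
/-- A `d`-algebra: ℓ-algebra in which `a ⊓ b = 0` implies `(a*c) ⊓ (b*c) = (c*a) ⊓ (c*b) = 0`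
for all `c ≥ 0`. -/
structure IsDAlgebra [Mul A] extends IsLAlgebra A : Prop where
  d_prop : ∀ a b c : A, a ⊓ b = 0 → 0 ≤ c → (a * c) ⊓ (b * c) = 0 ∧ (c * a) ⊓ (c * b) = 0

variable (A) in
/-- An `f`-algebra: ℓ-algebra in which `a ⊓ b = 0` implies `(a*c) ⊓ b = (c*a) ⊓ b = 0`
for all `c ≥ 0`. -/
structure IsFAlgebra [Mul A] extends IsLAlgebra A : Prop where
  f_prop : ∀ a b c : A, a ⊓ b = 0 → 0 ≤ c → (a * c) ⊓ b = 0 ∧ (c * a) ⊓ b = 0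

/-- `e` is a multiplicative unit. -/
def IsMulUnit [Mul A] (e : A) : Prop := ∀ a : A, a * e = a ∧ e * a = a

/-- `e` is an order unit. -/
def IsOrderUnit (e : A) : Prop := 0 ≤ e ∧ ∀ x : A, ∃ l : ℝ, 0 ≤ l ∧ |x| ≤ l • e

variable (A) in
/-- The algebra is semiprime: `0` is its only nilpotent element. -/
def IsSemiprime [Mul A] [Zero A] : Prop :=
  ∀ (a : A) (n : ℕ), 0 < n → mpow a n = 0 → a = 0

variable (A) in
/-- The vector lattice is uniformly complete. -/
def UniformlyComplete : Prop :=
  ∀ u : A, 0 ≤ u → ∀ f : ℕ → A,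
    (∀ ε : ℝ, 0 < ε → ∃ K : ℕ, ∀ m n : ℕ, K ≤ m → K ≤ n → |f m - f n| ≤ ε • u) →
    ∃ a : A, ∀ ε : ℝ, 0 < ε → ∃ K : ℕ, ∀ n : ℕ, K ≤ n → |f n - a| ≤ ε • u

variable (A) in
/-- The weak factorization property: every element is dominated by a product. -/
def WeakFactorization [Mul A] : Prop := ∀ a : A, ∃ b c : A, a ≤ b * c


namespace IsLAlgebra

variable [Mul A]

theorem isOrderedAddMonoid (hA : IsLAlgebra A) : IsOrderedAddMonoid A where
  add_le_add_left a b h c := by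
    rw [add_comm a c, add_comm b c]
    exact hA.add_le_add_left a b h c

theorem neg_mul (hA : IsLAlgebra A) (a b : A) : (-a) * b = -(a * b) := by
  have h := hA.smul_mul (-1) a b
  rwa [neg_one_smul, neg_one_smul] at h

theorem mul_neg (hA : IsLAlgebra A) (a b : A) : a * (-b) = -(a * b) := by
  have h := hA.mul_smul (-1) a b
  rwa [neg_one_smul, neg_one_smul] at h

theorem mul_le_mul_of_nonneg_left (hA : IsLAlgebra A) {a b c : A} (h : b ≤ c) (ha : 0 ≤ a) :
    a * b ≤ a * c := by
  have := hA.isOrderedAddMonoid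
  have h' := hA.mul_nonneg a (c - b) ha (sub_nonneg.2 h)
  rwa [sub_eq_add_neg, hA.left_distrib, hA.mul_neg, ← sub_eq_add_neg, sub_nonneg] at h'

theorem mul_le_mul_of_nonneg_right (hA : IsLAlgebra A) {a b c : A} (h : b ≤ c) (ha : 0 ≤ a) :
    b * a ≤ c * a := by
  have := hA.isOrderedAddMonoid
  have h' := hA.mul_nonneg (c - b) a (sub_nonneg.2 h) ha
  rwa [sub_eq_add_neg, hA.right_distrib, hA.neg_mul, ← sub_eq_add_neg, sub_nonneg] at h'

theorem mul_le_abs_mul_abs (hA : IsLAlgebra A) (a b : A) : a * b ≤ |a| * |b| := by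
  have := hA.isOrderedAddMonoid
  have h₁ := hA.mul_nonneg (|a| + -a) (|b| + b)
    (by simpa [← sub_eq_add_neg] using le_abs_self a) (neg_le_iff_add_nonneg.1 (neg_le_abs b))
  have h₂ := hA.mul_nonneg (|a| + a) (|b| + -b)
    (neg_le_iff_add_nonneg.1 (neg_le_abs a)) (by simpa [← sub_eq_add_neg] using le_abs_self b)
  simp only [hA.left_distrib, hA.right_distrib, hA.neg_mul, hA.mul_neg] at h₁ h₂
  have h := hA.smul_le_smul (1 / 2) _ _ (by norm_num) (add_nonneg h₁ h₂)
  rw [smul_zero] at h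
  rw [← sub_nonneg]
  refine h.trans_eq ?_
  module

theorem abs_mul_le (hA : IsLAlgebra A) (a b : A) : |a * b| ≤ |a| * |b| := by
  have := hA.isOrderedAddMonoid
  refine abs_le'.2 ⟨hA.mul_le_abs_mul_abs a b, ?_⟩
  rw [← hA.neg_mul, ← abs_neg a]
  exact hA.mul_le_abs_mul_abs (-a) b

theorem smul_le_smul_of_le (hA : IsLAlgebra A) {r s : ℝ} (h : r ≤ s) {a : A} (ha : 0 ≤ a) :
    r • a ≤ s • a := by
  have := hA.isOrderedAddMonoid
  have h' := hA.smul_le_smul (s - r) 0 a (sub_nonneg.2 h) ha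
  rwa [smul_zero, sub_smul, sub_nonneg] at h'

/-- A majorant of `φ` is a majorant of every element dominated by a multiple of `|φ|`. -/
theorem isMajorant_of_abs_le_smul (hA : IsLAlgebra A) {u φ ψ : A} (hu : IsMajorant u φ)
    {l : ℝ} (h : |ψ| ≤ l • |φ|) : IsMajorant u ψ := by
  have := hA.isOrderedAddMonoid
  refine ⟨hu.1, fun x ↦ ?_⟩
  obtain ⟨c, hc, hx⟩ := hu.2 x
  obtain ⟨N, hN⟩ := exists_nat_ge l
  have hψ : |ψ| ≤ N • |φ| := by
    rw [← Nat.cast_smul_eq_nsmul ℝ]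
    exact h.trans (hA.smul_le_smul_of_le hN (abs_nonneg φ))
  refine ⟨c, hc, fun n ↦ le_trans (inf_le_inf_left _ ?_) (hx (n * N))⟩
  rw [mul_nsmul']
  exact nsmul_le_nsmul_right hψ n

end IsLAlgebra

/-- In an ℓ-algebra with positive multiplicative unit `e`, multiplication by
`a ∈ I_e` preserves finiteness (resp. total finiteness) with the same majorant. -/
theorem stmt0 {A : Type*} [Lattice A] [AddCommGroup A] [Module ℝ A] [Mul A]
    (hA : IsLAlgebra A) (e : A) (he : 0 ≤ e) (hunit : IsMulUnit e)
    (a : A) (ha : ∃ l : ℝ, 0 ≤ l ∧ |a| ≤ l • e)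
    (φ u : A) (hu : IsMajorant u φ) :
    (IsMajorant u (φ * a) ∧ IsMajorant u (a * φ)) ∧
      (IsFiniteElt u →
        (IsMajorant u (φ * a) ∧ IsFiniteElt u) ∧ (IsMajorant u (a * φ) ∧ IsFiniteElt u) ∧
          IsTotallyFiniteElt (φ * a) ∧ IsTotallyFiniteElt (a * φ)) := by
  have := hA.isOrderedAddMonoid
  obtain ⟨l, -, hl⟩ := ha
  have h₁ : IsMajorant u (φ * a) := by
    refine hA.isMajorant_of_abs_le_smul (l := l) hu ((hA.abs_mul_le φ a).trans ?_)
    refine (hA.mul_le_mul_of_nonneg_left hl (abs_nonneg φ)).trans_eq ?_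
    rw [hA.mul_smul, (hunit _).1]
  have h₂ : IsMajorant u (a * φ) := by
    refine hA.isMajorant_of_abs_le_smul (l := l) hu ((hA.abs_mul_le a φ).trans ?_)
    refine (hA.mul_le_mul_of_nonneg_right hl (abs_nonneg φ)).trans_eq ?_
    rw [hA.smul_mul, (hunit _).2]
  exact ⟨⟨h₁, h₂⟩, fun hf ↦ ⟨⟨h₁, hf⟩, ⟨h₂, hf⟩, ⟨u, h₁, hf⟩, ⟨u, h₂, hf⟩⟩⟩

end FiniteElementsPaper
end

section
/- Let 𝒜 be a d-algebra with a (not necessarily positive) multiplicative unit e. If φ ∈ 𝒜 is a finite element and a ∈ 𝒜 is arbitrary, then the products a·φ and φ·a are finite elements of 𝒜; moreover, if φ ≥ 0 is finite with majorant u and a ≥ 0, then (a ∨ e)·u is a majorant of a·φ. In particular, the set Φ₁(𝒜) of finite elements is a ring ideal of 𝒜. -/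
namespace FiniteElementsPaper

variable {A : Type*} [Lattice A] [AddCommGroup A] [Module ℝ A]

theorem IsLAlgebra.isOrderedAddMonoid_s1 {A : Type*} [Lattice A] [AddCommGroup A] [Module ℝ A]
    [Mul A] (hA : IsLAlgebra A) : IsOrderedAddMonoid A where
  add_le_add_left a b h c := by
    simpa only [add_comm] using hA.add_le_add_left a b h c

theorem IsLAlgebra.posSMulMono {A : Type*} [Lattice A] [AddCommGroup A] [Module ℝ A]
    [Mul A] (hA : IsLAlgebra A) : PosSMulMono ℝ A where
  smul_le_smul_of_nonneg_left r hr a b h := hA.smul_le_smul r a b hr h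

theorem IsLAlgebra.mul_sub {A : Type*} [Lattice A] [AddCommGroup A] [Module ℝ A]
    [Mul A] (hA : IsLAlgebra A) (a b c : A) : a * (b - c) = a * b - a * c :=
  eq_sub_of_add_eq (by rw [← hA.left_distrib, sub_add_cancel])

theorem IsLAlgebra.sub_mul {A : Type*} [Lattice A] [AddCommGroup A] [Module ℝ A]
    [Mul A] (hA : IsLAlgebra A) (a b c : A) : (a - b) * c = a * c - b * c :=
  eq_sub_of_add_eq (by rw [← hA.right_distrib, sub_add_cancel])

theorem IsLAlgebra.mul_nsmul {A : Type*} [Lattice A] [AddCommGroup A] [Module ℝ A]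
    [Mul A] (hA : IsLAlgebra A) (n : ℕ) (a b : A) : a * (n • b) = n • (a * b) := by
  rw [← Nat.cast_smul_eq_nsmul ℝ, ← Nat.cast_smul_eq_nsmul ℝ, hA.mul_smul]

theorem IsLAlgebra.nsmul_mul {A : Type*} [Lattice A] [AddCommGroup A] [Module ℝ A]
    [Mul A] (hA : IsLAlgebra A) (n : ℕ) (a b : A) : (n • a) * b = n • (a * b) := by
  rw [← Nat.cast_smul_eq_nsmul ℝ, ← Nat.cast_smul_eq_nsmul ℝ, hA.smul_mul]

theorem IsLAlgebra.mul_le_mul_left {A : Type*} [Lattice A] [AddCommGroup A] [Module ℝ A]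
    [Mul A] (hA : IsLAlgebra A) {a b c : A} (hc : 0 ≤ c) (h : a ≤ b) : c * a ≤ c * b := by
  have := hA.isOrderedAddMonoid_s1
  rw [← sub_nonneg, ← hA.mul_sub]
  exact hA.mul_nonneg _ _ hc (sub_nonneg.2 h)

theorem IsLAlgebra.mul_le_mul_right {A : Type*} [Lattice A] [AddCommGroup A] [Module ℝ A]
    [Mul A] (hA : IsLAlgebra A) {a b c : A} (hc : 0 ≤ c) (h : a ≤ b) : a * c ≤ b * c := by
  have := hA.isOrderedAddMonoid_s1
  rw [← sub_nonneg, ← hA.sub_mul]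
  exact hA.mul_nonneg _ _ (sub_nonneg.2 h) hc

theorem inf_add_le_inf_add_inf {A : Type*} [Lattice A] [AddCommGroup A] [IsOrderedAddMonoid A]
    {w x y : A} (hw : 0 ≤ w) (hx : 0 ≤ x) (hy : 0 ≤ y) : w ⊓ (x + y) ≤ w ⊓ x + w ⊓ y := by
  rw [inf_add, add_inf, add_inf]
  exact le_inf (le_inf (inf_le_left.trans (le_add_of_nonneg_left hw))
    (inf_le_left.trans (le_add_of_nonneg_right hy)))
    (le_inf (inf_le_left.trans (le_add_of_nonneg_left hx)) inf_le_right)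

theorem inf_add_eq_zero {A : Type*} [Lattice A] [AddCommGroup A] [IsOrderedAddMonoid A]
    {w x y : A} (hx : w ⊓ x = 0) (hy : w ⊓ y = 0) : w ⊓ (x + y) = 0 := by
  have hw : 0 ≤ w := hx ▸ inf_le_left
  have hx' : 0 ≤ x := hx ▸ inf_le_right
  have hy' : 0 ≤ y := hy ▸ inf_le_right
  refine le_antisymm ?_ (le_inf hw (add_nonneg hx' hy'))
  simpa [hx, hy] using inf_add_le_inf_add_inf hw hx' hy'

theorem abs_sub_eq_add_of_inf_eq_zero {A : Type*} [Lattice A] [AddCommGroup A]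
    [IsOrderedAddMonoid A] {x y : A} (h : x ⊓ y = 0) : |x - y| = x + y := by
  have := sup_sub_inf_eq_abs_sub x y
  rw [← abs_sub_comm, ← this, h, sub_zero, ← inf_add_sup x y, h, zero_add]

theorem IsDAlgebra.mul_inf {A : Type*} [Lattice A] [AddCommGroup A] [Module ℝ A]
    [Mul A] (hA : IsDAlgebra A) {c : A} (hc : 0 ≤ c) (x y : A) :
    c * (x ⊓ y) = c * x ⊓ c * y := by
  have := hA.isOrderedAddMonoid_s1
  have h0 : (x - x ⊓ y) ⊓ (y - x ⊓ y) = 0 := by rw [← inf_sub, sub_self]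
  have h := (hA.d_prop _ _ c h0 hc).2
  rw [hA.mul_sub, hA.mul_sub, ← inf_sub] at h
  exact (sub_eq_zero.1 h).symm

theorem IsDAlgebra.inf_mul {A : Type*} [Lattice A] [AddCommGroup A] [Module ℝ A]
    [Mul A] (hA : IsDAlgebra A) {c : A} (hc : 0 ≤ c) (x y : A) :
    (x ⊓ y) * c = x * c ⊓ y * c := by
  have := hA.isOrderedAddMonoid_s1
  have h0 : (x - x ⊓ y) ⊓ (y - x ⊓ y) = 0 := by rw [← inf_sub, sub_self]
  have h := (hA.d_prop _ _ c h0 hc).1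
  rw [hA.sub_mul, hA.sub_mul, ← inf_sub] at h
  exact (sub_eq_zero.1 h).symm

theorem IsDAlgebra.abs_mul {A : Type*} [Lattice A] [AddCommGroup A] [Module ℝ A]
    [Mul A] (hA : IsDAlgebra A) (x y : A) : |x * y| = |x| * |y| := by
  have := hA.isOrderedAddMonoid_s1
  have hx : x⁺ ⊓ x⁻ = 0 := posPart_inf_negPart_eq_zero x
  have hy : y⁺ ⊓ y⁻ = 0 := posPart_inf_negPart_eq_zero y
  have h₁ := (hA.d_prop _ _ _ hx (posPart_nonneg y)).1
  have h₂ := (hA.d_prop _ _ _ hx (negPart_nonneg y)).1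
  have h₃ := (hA.d_prop _ _ _ hy (posPart_nonneg x)).2
  have h₄ := (hA.d_prop _ _ _ hy (negPart_nonneg x)).2
  have h : (x⁺ * y⁺ + x⁻ * y⁻) ⊓ (x⁺ * y⁻ + x⁻ * y⁺) = 0 := by
    rw [inf_comm]
    refine inf_add_eq_zero ?_ ?_ <;> rw [inf_comm]
    · exact inf_add_eq_zero h₃ h₁
    · exact inf_add_eq_zero (by rw [inf_comm, h₂]) (by rw [inf_comm, h₄])
  have hxy : x * y = (x⁺ * y⁺ + x⁻ * y⁻) - (x⁺ * y⁻ + x⁻ * y⁺) := by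
    conv_lhs => rw [← posPart_sub_negPart x, ← posPart_sub_negPart y]
    rw [hA.mul_sub, hA.sub_mul, hA.sub_mul]
    abel
  rw [hxy, abs_sub_eq_add_of_inf_eq_zero h, ← posPart_add_negPart x, ← posPart_add_negPart y,
    hA.left_distrib, hA.right_distrib, hA.right_distrib]
  abel

theorem isMajorant_abs {A : Type*} [Lattice A] [AddCommGroup A] [Module ℝ A]
    [IsOrderedAddMonoid A] {z φ : A} : IsMajorant z |φ| ↔ IsMajorant z φ := by
  simp only [IsMajorant, abs_abs]

theorem IsDAlgebra.isMajorant_mul_left {A : Type*} [Lattice A] [AddCommGroup A] [Module ℝ A]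
    [Mul A] (hA : IsDAlgebra A) {e : A} (he : IsMulUnit e) {φ a u : A} (hφ : 0 ≤ φ) (ha : 0 ≤ a)
    (hu : IsMajorant u φ) : IsMajorant ((a ⊔ e) * u) (a * φ) := by
  have := hA.isOrderedAddMonoid_s1
  have hb : 0 ≤ a ⊔ e := ha.trans le_sup_left
  refine ⟨hA.mul_nonneg _ _ hb hu.1, fun x => ?_⟩
  obtain ⟨c, hc, h⟩ := hu.2 x
  refine ⟨c, hc, fun n => ?_⟩
  have hn := h n
  rw [abs_of_nonneg hφ] at hn
  rw [abs_of_nonneg (hA.mul_nonneg _ _ ha hφ)]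
  calc |x| ⊓ n • (a * φ) ≤ (a ⊔ e) * |x| ⊓ (a ⊔ e) * (n • φ) := by
        refine inf_le_inf ?_ ?_
        · simpa only [(he |x|).2] using hA.mul_le_mul_right (abs_nonneg x) (le_sup_right : e ≤ a ⊔ e)
        · rw [← hA.mul_nsmul]
          exact hA.mul_le_mul_right (nsmul_nonneg hφ n) le_sup_left
    _ = (a ⊔ e) * (|x| ⊓ n • φ) := (hA.mul_inf hb _ _).symm
    _ ≤ (a ⊔ e) * (c • u) := hA.mul_le_mul_left hb hn
    _ = c • ((a ⊔ e) * u) := hA.mul_smul _ _ _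

theorem IsDAlgebra.isMajorant_mul_right {A : Type*} [Lattice A] [AddCommGroup A] [Module ℝ A]
    [Mul A] (hA : IsDAlgebra A) {e : A} (he : IsMulUnit e) {φ a u : A} (hφ : 0 ≤ φ) (ha : 0 ≤ a)
    (hu : IsMajorant u φ) : IsMajorant (u * (a ⊔ e)) (φ * a) := by
  have := hA.isOrderedAddMonoid_s1
  have hb : 0 ≤ a ⊔ e := ha.trans le_sup_left
  refine ⟨hA.mul_nonneg _ _ hu.1 hb, fun x => ?_⟩
  obtain ⟨c, hc, h⟩ := hu.2 x
  refine ⟨c, hc, fun n => ?_⟩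
  have hn := h n
  rw [abs_of_nonneg hφ] at hn
  rw [abs_of_nonneg (hA.mul_nonneg _ _ hφ ha)]
  calc |x| ⊓ n • (φ * a) ≤ |x| * (a ⊔ e) ⊓ (n • φ) * (a ⊔ e) := by
        refine inf_le_inf ?_ ?_
        · simpa only [(he |x|).1] using hA.mul_le_mul_left (abs_nonneg x) (le_sup_right : e ≤ a ⊔ e)
        · rw [← hA.nsmul_mul]
          exact hA.mul_le_mul_left (nsmul_nonneg hφ n) le_sup_left
    _ = (|x| ⊓ n • φ) * (a ⊔ e) := (hA.inf_mul hb _ _).symm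
    _ ≤ (c • u) * (a ⊔ e) := hA.mul_le_mul_right hb hn
    _ = c • (u * (a ⊔ e)) := hA.smul_mul _ _ _

theorem IsMajorant.add {A : Type*} [Lattice A] [AddCommGroup A] [Module ℝ A]
    [IsOrderedAddMonoid A] [PosSMulMono ℝ A] {u v x y : A} (hu : IsMajorant u x)
    (hv : IsMajorant v y) : IsMajorant (u + v) (x + y) := by
  refine ⟨add_nonneg hu.1 hv.1, fun w => ?_⟩
  obtain ⟨c, hc, h⟩ := hu.2 w
  obtain ⟨d, hd, k⟩ := hv.2 w
  refine ⟨c + d, add_pos hc hd, fun n => ?_⟩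
  calc |w| ⊓ n • |x + y| ≤ |w| ⊓ (n • |x| + n • |y|) := by
        rw [← nsmul_add]
        exact inf_le_inf_left _ (nsmul_le_nsmul_right (abs_add_le x y) n)
    _ ≤ |w| ⊓ n • |x| + |w| ⊓ n • |y| :=
        inf_add_le_inf_add_inf (abs_nonneg w) (nsmul_nonneg (abs_nonneg x) n)
          (nsmul_nonneg (abs_nonneg y) n)
    _ ≤ c • u + d • v := add_le_add (h n) (k n)
    _ ≤ (c • u + d • v) + (d • u + c • v) :=
        le_add_of_nonneg_right (add_nonneg (smul_nonneg hd.le hu.1) (smul_nonneg hc.le hv.1))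
    _ = (c + d) • (u + v) := by module

/-- In a d-algebra with a (not necessarily positive) multiplicative unit,
products of an arbitrary element with a finite element are finite; for `0 ≤ φ` finite with
majorant `u` and `0 ≤ a`, `(a ⊔ e) * u` is a majorant of `a * φ`; and `Φ₁(𝒜)` is a ring
ideal. -/
theorem stmt1 {A : Type*} [Lattice A] [AddCommGroup A] [Module ℝ A] [Mul A]
    (hA : IsDAlgebra A) (e : A) (hunit : IsMulUnit e) :
    (∀ φ a : A, IsFiniteElt φ → IsFiniteElt (a * φ) ∧ IsFiniteElt (φ * a)) ∧
    (∀ φ a u : A, 0 ≤ φ → 0 ≤ a → IsMajorant u φ → IsMajorant ((a ⊔ e) * u) (a * φ)) ∧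
    (∀ x y : A, IsFiniteElt x → IsFiniteElt y → IsFiniteElt (x + y)) ∧
    (∀ x : A, IsFiniteElt x → IsFiniteElt (-x)) := by
  have := hA.isOrderedAddMonoid_s1
  have := hA.posSMulMono
  refine ⟨?_, fun φ a u hφ ha hu => hA.isMajorant_mul_left hunit hφ ha hu, ?_, ?_⟩
  · rintro φ a ⟨u, hu⟩
    rw [← isMajorant_abs] at hu
    constructor
    · refine ⟨(|a| ⊔ e) * u, isMajorant_abs.1 ?_⟩
      rw [hA.abs_mul]
      exact hA.isMajorant_mul_left hunit (abs_nonneg φ) (abs_nonneg a) hu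
    · refine ⟨u * (|a| ⊔ e), isMajorant_abs.1 ?_⟩
      rw [hA.abs_mul]
      exact hA.isMajorant_mul_right hunit (abs_nonneg φ) (abs_nonneg a) hu
  · rintro x y ⟨u, hu⟩ ⟨v, hv⟩
    exact ⟨u + v, hu.add hv⟩
  · rintro x ⟨u, hu⟩
    exact ⟨u, by simpa only [IsMajorant, abs_neg] using hu⟩

end FiniteElementsPaper
end

section
/- Let 𝒜 be a semiprime uniformly complete f-algebra with the weak factorization property and let p ∈ ℕ with p ≥ 2. If φ ∈ Φ₁(𝒜) is a finite element that possesses a p-th root φ^(1/p) in 𝒜 (an element b with b^p = φ), then φ^(1/p) is also a finite element of 𝒜. -/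
namespace FiniteElementsPaper

variable {A : Type*} [Lattice A] [AddCommGroup A] [Module ℝ A]

section PowerLemmas

theorem mpow_one {R : Type*} [Mul R] [Zero R] (a : R) : mpow a 1 = a := by
  simp [mpow, mulProd]

theorem mpow_add_two {R : Type*} [Mul R] [Zero R] (a : R) (k : ℕ) :
    mpow a (k + 2) = mpow a (k + 1) * a := by
  simp [mpow, mulProd, Fin.foldl_succ_last]

theorem mpow_smul {R : Type*} [NonUnitalRing R] [Module ℝ R] [IsScalarTower ℝ R R]
    [SMulCommClass ℝ R R] (r : ℝ) (a : R) (k : ℕ) :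
    mpow (r • a) (k + 1) = r ^ (k + 1) • mpow a (k + 1) := by
  induction k with
  | zero => simp [mpow_one]
  | succ k ih =>
    rw [mpow_add_two, mpow_add_two, ih, smul_mul_assoc, mul_smul_comm, smul_smul, ← pow_succ]

variable {R : Type*} [NonUnitalRing R] [Lattice R] [PosMulMono R]

theorem mpow_nonneg {a : R} (ha : 0 ≤ a) (k : ℕ) : 0 ≤ mpow a (k + 1) := by
  induction k with
  | zero => rwa [mpow_one]
  | succ k ih => rw [mpow_add_two]; exact mul_nonneg ih ha

variable [MulPosMono R]

theorem mpow_le_mpow {a b : R} (ha : 0 ≤ a) (hab : a ≤ b) (k : ℕ) :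
    mpow a (k + 1) ≤ mpow b (k + 1) := by
  induction k with
  | zero => rwa [mpow_one, mpow_one]
  | succ k ih =>
    rw [mpow_add_two, mpow_add_two]
    exact mul_le_mul_of_nonneg ih hab (mpow_nonneg ha k) (ha.trans hab)

variable [IsOrderedAddMonoid R]

theorem mpow_add_mpow_le {a b : R} (ha : 0 ≤ a) (hb : 0 ≤ b) (k : ℕ) :
    mpow a (k + 1) + mpow b (k + 1) ≤ mpow (a + b) (k + 1) := by
  induction k with
  | zero => simp [mpow_one]
  | succ k ih =>
    rw [mpow_add_two, mpow_add_two, mpow_add_two]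
    refine le_trans ?_ (mul_le_mul_of_nonneg_right ih (add_nonneg ha hb))
    have h₁ := mul_nonneg (mpow_nonneg ha k) hb
    have h₂ := mul_nonneg (mpow_nonneg hb k) ha
    calc _ ≤ mpow a (k + 1) * a + mpow b (k + 1) * b
          + (mpow a (k + 1) * b + mpow b (k + 1) * a) := le_add_of_nonneg_right (add_nonneg h₁ h₂)
      _ = _ := by rw [add_mul, mul_add, mul_add]; abel

end PowerLemmas

section Disjointness

variable {G : Type*} [Lattice G] [AddCommGroup G] [IsOrderedAddMonoid G]

theorem add_inf_eq_zero {a b d : G} (ha : a ⊓ d = 0) (hb : b ⊓ d = 0) : (a + b) ⊓ d = 0 := by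
  have ha0 : 0 ≤ a := ha ▸ inf_le_left
  have hb0 : 0 ≤ b := hb ▸ inf_le_left
  have hd0 : 0 ≤ d := ha ▸ inf_le_right
  refine le_antisymm ?_ (le_inf (add_nonneg ha0 hb0) hd0)
  have h : (a + b) ⊓ d ≤ b := by
    calc (a + b) ⊓ d ≤ (a + b) ⊓ (d + b) :=
          inf_le_inf_left _ (le_add_of_nonneg_right hb0)
      _ = b := by rw [← inf_add, ha, zero_add]
  calc (a + b) ⊓ d ≤ b ⊓ d := le_inf h inf_le_right
    _ = 0 := hb

theorem abs_sub_of_inf_eq_zero {a b : G} (h : a ⊓ b = 0) : |a - b| = a + b := by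
  have h₁ := inf_add_sup a b
  have h₂ := sup_sub_inf_eq_abs_sub a b
  rw [h, zero_add] at h₁
  rw [h, sub_zero, h₁] at h₂
  rw [abs_sub_comm, ← h₂]

end Disjointness

section FAlgebra

theorem mpow_inf_eq_zero {R : Type*} [NonUnitalRing R] [Lattice R]
    (hf : ∀ a b c : R, a ⊓ b = 0 → 0 ≤ c → (a * c) ⊓ b = 0 ∧ (c * a) ⊓ b = 0)
    {a d : R} (had : a ⊓ d = 0) (k : ℕ) : mpow a (k + 1) ⊓ d = 0 := by
  induction k with
  | zero => rwa [mpow_one]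
  | succ k ih =>
    rw [mpow_add_two]
    exact (hf _ _ _ ih (had ▸ inf_le_left)).1

variable {R : Type*} [NonUnitalRing R] [Lattice R] [IsOrderedAddMonoid R]

theorem abs_mul_of_fAlgebra
    (hf : ∀ a b c : R, a ⊓ b = 0 → 0 ≤ c → (a * c) ⊓ b = 0 ∧ (c * a) ⊓ b = 0)
    (a b : R) : |a * b| = |a| * |b| := by
  have hr : ∀ {x y c : R}, x ⊓ y = 0 → 0 ≤ c → (x * c) ⊓ (y * c) = 0 := fun h hc => by
    rw [inf_comm]
    exact (hf _ _ _ ((inf_comm _ _).trans (hf _ _ _ h hc).1) hc).1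
  have hl : ∀ {x y c : R}, x ⊓ y = 0 → 0 ≤ c → (c * x) ⊓ (c * y) = 0 := fun h hc => by
    rw [inf_comm]
    exact (hf _ _ _ ((inf_comm _ _).trans (hf _ _ _ h hc).2) hc).2
  have ha := posPart_inf_negPart_eq_zero a
  have hb := posPart_inf_negPart_eq_zero b
  have hap := posPart_nonneg a
  have han := negPart_nonneg a
  have hbp := posPart_nonneg b
  have hbn := negPart_nonneg b
  have h : (a⁺ * b⁺ + a⁻ * b⁻) ⊓ (a⁺ * b⁻ + a⁻ * b⁺) = 0 := by
    apply add_inf_eq_zero <;> rw [inf_comm] <;> apply add_inf_eq_zero <;> rw [inf_comm]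
    · exact hl hb hap
    · exact hr ha hbp
    · rw [inf_comm]; exact hr ha hbn
    · rw [inf_comm]; exact hl hb han
  have hab : a * b = (a⁺ * b⁺ + a⁻ * b⁻) - (a⁺ * b⁻ + a⁻ * b⁺) := by
    conv_lhs => rw [← posPart_sub_negPart a, ← posPart_sub_negPart b]
    noncomm_ring
  rw [hab, abs_sub_of_inf_eq_zero h, ← posPart_add_negPart a, ← posPart_add_negPart b,
    add_mul, mul_add, mul_add]
  abel

theorem abs_mpow
    (hf : ∀ a b c : R, a ⊓ b = 0 → 0 ≤ c → (a * c) ⊓ b = 0 ∧ (c * a) ⊓ b = 0)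
    (a : R) (k : ℕ) : |mpow a (k + 1)| = mpow |a| (k + 1) := by
  induction k with
  | zero => simp [mpow_one]
  | succ k ih => rw [mpow_add_two, mpow_add_two, abs_mul_of_fAlgebra hf, ih]

variable [PosMulMono R] [MulPosMono R]

/-- The expansion of `(m + e) ^ (k + 1)` is `m ^ (k + 1)` plus terms disjoint from every element
disjoint from `e`. -/
theorem exists_mpow_add_eq_add_inf_eq_zero
    (hf : ∀ a b c : R, a ⊓ b = 0 → 0 ≤ c → (a * c) ⊓ b = 0 ∧ (c * a) ⊓ b = 0)
    {m e d : R} (hm : 0 ≤ m) (hed : e ⊓ d = 0) (k : ℕ) :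
    ∃ r : R, mpow (m + e) (k + 1) = mpow m (k + 1) + r ∧ r ⊓ d = 0 := by
  have he : 0 ≤ e := hed ▸ inf_le_left
  induction k with
  | zero => exact ⟨e, by simp [mpow_one], hed⟩
  | succ k ih =>
    obtain ⟨r, hr, hrd⟩ := ih
    refine ⟨mpow m (k + 1) * e + r * (m + e), ?_, ?_⟩
    · rw [mpow_add_two, hr, mpow_add_two, add_mul, mul_add, add_assoc]
    · exact add_inf_eq_zero (hf _ _ _ hed (mpow_nonneg hm k)).2
        (hf _ _ _ hrd (add_nonneg hm he)).1

/-- In a semiprime f-algebra taking powers reflects the order of positive elements. -/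
theorem le_of_mpow_le_mpow
    (hf : ∀ a b c : R, a ⊓ b = 0 → 0 ≤ c → (a * c) ⊓ b = 0 ∧ (c * a) ⊓ b = 0)
    (hsp : IsSemiprime R) {u v : R} (hu : 0 ≤ u) (hv : 0 ≤ v) (k : ℕ)
    (h : mpow u (k + 1) ≤ mpow v (k + 1)) : u ≤ v := by
  have hm : 0 ≤ u ⊓ v := le_inf hu hv
  have hd : 0 ≤ u - u ⊓ v := sub_nonneg.2 inf_le_left
  have hed : (v - u ⊓ v) ⊓ (u - u ⊓ v) = 0 := by
    rw [← inf_sub, inf_comm, sub_self]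
  obtain ⟨r, hr, hrd⟩ := exists_mpow_add_eq_add_inf_eq_zero hf hm hed k
  have hle := mpow_add_mpow_le hm hd k
  rw [add_sub_cancel] at hr hle
  have hdr : mpow (u - u ⊓ v) (k + 1) ≤ r := by
    have := hle.trans (h.trans_eq hr)
    exact le_of_add_le_add_left this
  have hzero := mpow_inf_eq_zero hf ((inf_comm _ _).trans hrd) k
  rw [inf_eq_left.2 hdr] at hzero
  have := hsp _ _ k.succ_pos hzero
  exact inf_eq_left.1 (sub_eq_zero.1 this).symm

theorem exists_le_mpow
    (hf : ∀ a b c : R, a ⊓ b = 0 → 0 ≤ c → (a * c) ⊓ b = 0 ∧ (c * a) ⊓ b = 0)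
    (hwf : WeakFactorization R) (k : ℕ) (z : R) :
    ∃ w : R, 0 ≤ w ∧ z ≤ mpow w (k + 1) := by
  induction k generalizing z with
  | zero => exact ⟨|z|, abs_nonneg z, by rw [mpow_one]; exact le_abs_self z⟩
  | succ k ih =>
    obtain ⟨a, b, hab⟩ := hwf z
    obtain ⟨w, hw, haw⟩ := ih |a|
    have hwb : 0 ≤ w + |b| := add_nonneg hw (abs_nonneg b)
    refine ⟨w + |b|, hwb, ?_⟩
    rw [mpow_add_two]
    calc z ≤ |a * b| := hab.trans (le_abs_self _)
      _ = |a| * |b| := abs_mul_of_fAlgebra hf a b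
      _ ≤ _ := mul_le_mul_of_nonneg
        (haw.trans (mpow_le_mpow hw (le_add_of_nonneg_right (abs_nonneg b)) k))
        (le_add_of_nonneg_left hw) (abs_nonneg a) hwb

theorem isFiniteElt_of_mpow
    (hf : ∀ a b c : R, a ⊓ b = 0 → 0 ≤ c → (a * c) ⊓ b = 0 ∧ (c * a) ⊓ b = 0)
    [Module ℝ R] [IsScalarTower ℝ R R] [SMulCommClass ℝ R R] [PosSMulMono ℝ R]
    (hsp : IsSemiprime R) (hwf : WeakFactorization R) (k : ℕ) (b : R)
    (h : IsFiniteElt (mpow b (k + 1))) : IsFiniteElt b := by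
  obtain ⟨z, hz, hzb⟩ := h
  obtain ⟨w, hw, hzw⟩ := exists_le_mpow hf hwf k z
  refine ⟨w, hw, fun x => ?_⟩
  obtain ⟨c, hc, hcn⟩ := hzb (mpow x (k + 1))
  have hr : 1 ≤ max 1 c := le_max_left _ _
  have hr0 : 0 < max 1 c := one_pos.trans_le hr
  refine ⟨max 1 c, hr0, fun n => ?_⟩
  have hnb : 0 ≤ n • |b| := nsmul_nonneg (abs_nonneg b) n
  have hxb : 0 ≤ |x| ⊓ n • |b| := le_inf (abs_nonneg x) hnb
  have hcr : 0 ≤ max 1 c ^ (k + 1) - c :=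
    sub_nonneg.2 ((le_max_right 1 c).trans (le_self_pow₀ hr k.succ_ne_zero))
  refine le_of_mpow_le_mpow hf hsp hxb (smul_nonneg hr0.le hw) k ?_
  calc mpow (|x| ⊓ n • |b|) (k + 1)
      ≤ mpow |x| (k + 1) ⊓ mpow (n • |b|) (k + 1) :=
        le_inf (mpow_le_mpow hxb inf_le_left k) (mpow_le_mpow hxb inf_le_right k)
    _ = |mpow x (k + 1)| ⊓ n ^ (k + 1) • |mpow b (k + 1)| := by
        rw [abs_mpow hf, abs_mpow hf, ← Nat.cast_smul_eq_nsmul ℝ, mpow_smul,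
          ← Nat.cast_smul_eq_nsmul ℝ, Nat.cast_pow]
    _ ≤ c • z := hcn _
    _ ≤ max 1 c ^ (k + 1) • z := by
        rw [← sub_nonneg, ← sub_smul]
        exact smul_nonneg hcr hz
    _ ≤ max 1 c ^ (k + 1) • mpow w (k + 1) :=
        smul_le_smul_of_nonneg_left hzw (pow_nonneg hr0.le _)
    _ = mpow (max 1 c • w) (k + 1) := (mpow_smul _ _ _).symm

end FAlgebra

/-- In a semiprime uniformly complete f-algebra with the weak factorization
property, a p-th root of a finite element is finite. -/
theorem stmt8 {A : Type*} [Lattice A] [AddCommGroup A] [Module ℝ A] [Mul A]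
    (hA : IsFAlgebra A) (hsp : IsSemiprime A) (huc : UniformlyComplete A)
    (hwf : WeakFactorization A) (p : ℕ) (hp : 2 ≤ p)
    (φ : A) (hφ : IsFiniteElt φ) (b : A) (hb : mpow b p = φ) :
    IsFiniteElt b := by
  let _ : NonUnitalRing A :=
    { ‹AddCommGroup A›, ‹Mul A› with
      left_distrib := hA.left_distrib
      right_distrib := hA.right_distrib
      mul_assoc := hA.mul_assoc
      zero_mul := fun a => by simpa using hA.smul_mul 0 0 a
      mul_zero := fun a => by simpa using hA.mul_smul 0 a 0 }
  have : IsOrderedAddMonoid A :=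
    { add_le_add_left := fun a b h c => by
        rw [add_comm a, add_comm b]; exact hA.add_le_add_left a b h c }
  have : PosMulMono A := ⟨fun c hc a b h => by
    rw [← sub_nonneg, ← mul_sub]
    exact hA.mul_nonneg _ _ hc (sub_nonneg.2 h)⟩
  have : MulPosMono A := ⟨fun c hc a b h => by
    rw [← sub_nonneg, ← sub_mul]
    exact hA.mul_nonneg _ _ (sub_nonneg.2 h) hc⟩
  have : IsScalarTower ℝ A A := ⟨hA.smul_mul⟩
  have : SMulCommClass ℝ A A := ⟨fun r a b => (hA.mul_smul r a b).symm⟩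
  have : PosSMulMono ℝ A := ⟨fun r hr a b h => hA.smul_le_smul r a b hr h⟩
  obtain ⟨k, rfl⟩ : ∃ k, p = k + 1 := ⟨p - 1, by omega⟩
  exact isFiniteElt_of_mpow hA.f_prop hsp hwf k b (hb ▸ hφ)

end FiniteElementsPaper
end

section
/- Let 𝒜 be an f-algebra (not assumed to have a multiplicative unit). If φ ∈ Φ₁(𝒜) is a finite element and a ∈ 𝒜 is arbitrary, then the product a·φ is a finite element of 𝒜. In particular, Φ₁(𝒜) is a ring ideal of 𝒜 closed under multiplication. -/
namespace FiniteElementsPaper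

variable {A : Type*} [Lattice A] [AddCommGroup A] [Module ℝ A]

section OrderedGroup

variable {G : Type*} [Lattice G] [AddCommGroup G] [IsOrderedAddMonoid G]

theorem inf_add_le_inf_add_inf_s10 {x s t : G} (hx : 0 ≤ x) (hs : 0 ≤ s) (ht : 0 ≤ t) :
    x ⊓ (s + t) ≤ x ⊓ s + x ⊓ t := by
  rw [add_inf, inf_add, inf_add]
  refine le_inf (le_inf ?_ ?_) (le_inf ?_ ?_)
  · exact inf_le_left.trans (le_add_of_nonneg_right hx)
  · exact inf_le_left.trans (le_add_of_nonneg_left hs)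
  · exact inf_le_left.trans (le_add_of_nonneg_right ht)
  · exact inf_le_right

theorem inf_nsmul_eq_zero {v t : G} (hv : 0 ≤ v) (ht : 0 ≤ t) (h : v ⊓ t = 0) (n : ℕ) :
    v ⊓ n • t = 0 := by
  induction n with
  | zero => simpa using hv
  | succ n ih =>
    refine le_antisymm ?_ (le_inf hv (nsmul_nonneg ht _))
    rw [succ_nsmul]
    refine (inf_add_le_inf_add_inf_s10 hv (nsmul_nonneg ht n) ht).trans ?_
    rw [ih, h, add_zero]

/-- In an Archimedean lattice-ordered group, if every truncation `u ⊓ n • φ` lies below `w`,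
then the part of `u` above `w` is disjoint from `φ`. -/
theorem inf_sub_inf_eq_zero
    (arch : ∀ a b : G, 0 ≤ a → (∀ n : ℕ, n • a ≤ b) → a = 0) {u w φ : G}
    (hu : 0 ≤ u) (hφ : 0 ≤ φ) (h : ∀ n : ℕ, u ⊓ n • φ ≤ w) :
    φ ⊓ (u - u ⊓ w) = 0 := by
  refine arch _ u (le_inf hφ (sub_nonneg.2 inf_le_left)) fun n => ?_
  induction n with
  | zero => simpa using hu
  | succ n ih =>
    have hn : n • (φ ⊓ (u - u ⊓ w)) ≤ u ⊓ w :=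
      le_inf ih ((le_inf ih (nsmul_le_nsmul_right inf_le_left n)).trans (h n))
    rw [succ_nsmul]
    exact (add_le_add hn inf_le_right).trans (by rw [add_sub_cancel])

end OrderedGroup

namespace IsLAlgebra

variable [Mul A]

theorem mul_sub_s10 (hA : IsLAlgebra A) (a b c : A) : a * (b - c) = a * b - a * c := by
  rw [eq_sub_iff_add_eq, ← hA.left_distrib, sub_add_cancel]

theorem sub_mul_s10 (hA : IsLAlgebra A) (a b c : A) : (a - b) * c = a * c - b * c := by
  rw [eq_sub_iff_add_eq, ← hA.right_distrib, sub_add_cancel]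

end IsLAlgebra

/-- A majorant of `φ` is a majorant of every `ψ` dominated by some `t` that is disjoint from
each positive element disjoint from `φ`. -/
theorem IsMajorant.of_abs_le_of_disjoint [IsOrderedAddMonoid A]
    (arch : ∀ a b : A, 0 ≤ a → (∀ n : ℕ, n • a ≤ b) → a = 0) {z φ ψ t : A}
    (hz : IsMajorant z φ) (hψ : |ψ| ≤ t) (ht : ∀ v : A, |φ| ⊓ v = 0 → t ⊓ v = 0) :
    IsMajorant z ψ := by
  refine ⟨hz.1, fun x => ?_⟩
  obtain ⟨c, hc, h⟩ := hz.2 x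
  refine ⟨c, hc, fun n => ?_⟩
  have ht₀ : 0 ≤ t := (abs_nonneg ψ).trans hψ
  set u := |x| ⊓ n • t
  have hu₀ : 0 ≤ u := le_inf (abs_nonneg x) (nsmul_nonneg ht₀ n)
  have hux : ∀ m : ℕ, u ⊓ m • |φ| ≤ c • z := fun m =>
    (inf_le_inf_right _ inf_le_left).trans (h m)
  have hv := ht _ (inf_sub_inf_eq_zero arch hu₀ (abs_nonneg φ) hux)
  set v := u - u ⊓ c • z
  have hv₀ : 0 ≤ v := sub_nonneg.2 inf_le_left
  have hzero : v ⊓ n • t = 0 := inf_nsmul_eq_zero hv₀ ht₀ (by rwa [inf_comm]) n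
  have hw₀ : 0 ≤ u ⊓ c • z := le_inf hu₀ (by simpa [hu₀] using hux 0)
  have hvt : v ≤ n • t := (sub_le_self u hw₀).trans inf_le_right
  have huz : u = u ⊓ c • z := sub_eq_zero.1 ((inf_eq_left.2 hvt).symm.trans hzero)
  exact (inf_le_inf_left _ (nsmul_le_nsmul_right hψ n)).trans (inf_eq_left.1 huz.symm)

section FAlgebra

variable [Mul A]

theorem IsFiniteElt.mul_left (hA : IsFAlgebra A) (a : A) {φ : A} (hφ : IsFiniteElt φ) :
    IsFiniteElt (a * φ) := by
  have := hA.isOrderedAddMonoid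
  obtain ⟨z, hz⟩ := hφ
  exact ⟨z, hz.of_abs_le_of_disjoint hA.archimedean (hA.abs_mul_le a φ)
    fun v hv => (hA.f_prop _ v |a| hv (abs_nonneg a)).2⟩

theorem IsFiniteElt.mul_right (hA : IsFAlgebra A) (a : A) {φ : A} (hφ : IsFiniteElt φ) :
    IsFiniteElt (φ * a) := by
  have := hA.isOrderedAddMonoid
  obtain ⟨z, hz⟩ := hφ
  exact ⟨z, hz.of_abs_le_of_disjoint hA.archimedean (hA.abs_mul_le φ a)
    fun v hv => (hA.f_prop _ v |a| hv (abs_nonneg a)).1⟩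

theorem IsFiniteElt.add (hA : IsLAlgebra A) {x y : A} (hx : IsFiniteElt x)
    (hy : IsFiniteElt y) : IsFiniteElt (x + y) := by
  have := hA.isOrderedAddMonoid
  obtain ⟨z, hz, hxz⟩ := hx
  obtain ⟨w, hw, hyw⟩ := hy
  refine ⟨z + w, add_nonneg hz hw, fun b => ?_⟩
  obtain ⟨c, hc, hcz⟩ := hxz b
  obtain ⟨d, hd, hdw⟩ := hyw b
  refine ⟨c + d, add_pos hc hd, fun n => ?_⟩
  have hdz : 0 ≤ d • z := by simpa using hA.smul_le_smul d 0 z hd.le hz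
  have hcw : 0 ≤ c • w := by simpa using hA.smul_le_smul c 0 w hc.le hw
  calc |b| ⊓ n • |x + y| ≤ |b| ⊓ (n • |x| + n • |y|) := by
        rw [← nsmul_add]
        exact inf_le_inf_left _ (nsmul_le_nsmul_right (abs_add_le x y) n)
    _ ≤ |b| ⊓ n • |x| + |b| ⊓ n • |y| :=
        inf_add_le_inf_add_inf_s10 (abs_nonneg b) (nsmul_nonneg (abs_nonneg x) n)
          (nsmul_nonneg (abs_nonneg y) n)
    _ ≤ c • z + d • w := add_le_add (hcz n) (hdw n)
    _ ≤ c • z + d • z + (c • w + d • w) :=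
        add_le_add (le_add_of_nonneg_right hdz) (le_add_of_nonneg_left hcw)
    _ = (c + d) • (z + w) := by rw [smul_add, add_smul, add_smul]

end FAlgebra

theorem IsFiniteElt.neg {x : A} (hx : IsFiniteElt x) : IsFiniteElt (-x) := by
  simpa only [IsFiniteElt, IsMajorant, abs_neg] using hx

/-- In an f-algebra (no multiplicative unit assumed), the product of an
arbitrary element with a finite element is finite; in particular `Φ₁(𝒜)` is a ring ideal
closed under multiplication. -/
theorem stmt10 {A : Type*} [Lattice A] [AddCommGroup A] [Module ℝ A] [Mul A]
    (hA : IsFAlgebra A) :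
    (∀ a φ : A, IsFiniteElt φ → IsFiniteElt (a * φ)) ∧
    (∀ a φ : A, IsFiniteElt φ → IsFiniteElt (φ * a)) ∧
    (∀ x y : A, IsFiniteElt x → IsFiniteElt y → IsFiniteElt (x + y)) ∧
    (∀ x : A, IsFiniteElt x → IsFiniteElt (-x)) := by
  exact ⟨fun a _ h => h.mul_left hA a, fun a _ h => h.mul_right hA a,
    fun _ _ hx hy => hx.add hA.toIsLAlgebra hy, fun _ hx => hx.neg⟩

end FiniteElementsPaper
end
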